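/- arXiv:math/0511419 — 2 statements merged into one kernel-verified Lean document; each statement's English description precedes it below -/
import Mathlib

section
/- For k, n ≥ 1, b_k(n) = (1/2^{k-1}) Σ (-2)^s C(k-s, (k+r)/2) C(n,s) r^n, where the sum is over nonnegative integers r, s with r + 2s ≤ k and r ≡ k (mod 2). -/
/-- The list of values of a permutation of `Fin n` (0-indexed; relative order
is what matters). -/
def permList (n : ℕ) (w : Equiv.Perm (Fin n)) : List ℕ :=
  List.ofFn (fun i => (w i : ℕ))

/-- A list is alternating: `a > b < c > d < ⋯` (descents in even positions). -/
def IsAlt (l : List ℕ) : Prop :=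
  ∀ i : ℕ, ∀ hi : i + 1 < l.length,
    if i % 2 = 0 then l.get ⟨i + 1, hi⟩ < l.get ⟨i, Nat.lt_of_succ_lt hi⟩
    else l.get ⟨i, Nat.lt_of_succ_lt hi⟩ < l.get ⟨i + 1, hi⟩

/-- `asLen n w` : the maximum length of an alternating subsequence of `w`. -/
noncomputable def asLen (n : ℕ) (w : Equiv.Perm (Fin n)) : ℕ :=
  sSup {k | ∃ l : List ℕ, l.Sublist (permList n w) ∧ IsAlt l ∧ l.length = k}

/-- `aCount n k = #{w ∈ S_n : as(w) = k}`. -/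
noncomputable def aCount (n k : ℕ) : ℕ :=
  Nat.card {w : Equiv.Perm (Fin n) // asLen n w = k}

/-- `bCount n k = #{w ∈ S_n : as(w) ≤ k}`. -/
noncomputable def bCount (n k : ℕ) : ℕ :=
  Nat.card {w : Equiv.Perm (Fin n) // asLen n w ≤ k}

/-- Number of direction changes met when reading a list after the entry `p`, where `b` records
whether the current direction is upwards. -/
def turns : Bool → ℕ → List ℕ → ℕ
  | _, _, [] => 0
  | b, p, x :: l => if decide (x < p) = b then turns (!b) x l + 1 else turns b x l

/-- `ZigZag b p l`: the list `p :: l` alternates, starting with a descent iff `b = true`. -/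
def ZigZag : Bool → ℕ → List ℕ → Prop
  | _, _, [] => True
  | b, p, x :: l => (if b then x < p else p < x) ∧ ZigZag (!b) x l

theorem zigZag_iff_get (b : Bool) (p : ℕ) (l : List ℕ) :
    ZigZag b p l ↔ ∀ i : ℕ, ∀ hi : i + 1 < (p :: l).length,
      if decide (i % 2 = 0) = b then (p :: l)[i + 1] < (p :: l)[i]
      else (p :: l)[i] < (p :: l)[i + 1] := by
  induction l generalizing b p with
  | nil => simp [ZigZag]
  | cons x l ih =>
    rw [ZigZag, ih]
    constructor
    · rintro ⟨h₀, h⟩ i hi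
      cases i with
      | zero => cases b <;> simpa using h₀
      | succ i =>
        have := h i (by simpa using hi)
        rcases Nat.mod_two_eq_zero_or_one i with hi2 | hi2 <;> cases b <;>
          simpa [Nat.add_mod, hi2] using this
    · intro h
      refine ⟨by cases b <;> simpa using h 0 (by simp), fun i hi => ?_⟩
      have := h (i + 1) (by simpa using hi)
      rcases Nat.mod_two_eq_zero_or_one i with hi2 | hi2 <;> cases b <;>
        simpa [Nat.add_mod, hi2] using this

theorem isAlt_cons_iff (p : ℕ) (l : List ℕ) : IsAlt (p :: l) ↔ ZigZag true p l := by
  rw [zigZag_iff_get]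
  simp [IsAlt]

/-- Greedy upper bounds on alternating sublists: `turns` is optimal, and loses at most one if
the direction is wrong. -/
theorem ZigZag.length_le_turns (l : List ℕ) :
    (∀ b p q m, m.Sublist l → ZigZag b q m → (if b then q ≤ p else p ≤ q) →
      m.length ≤ turns b p l) ∧
    (∀ b p q m, m.Sublist l → ZigZag b q m → m.length ≤ turns (!b) p l + 1) := by
  induction l with
  | nil => simp +contextual [turns]
  | cons x l ih =>
    obtain ⟨ih₁, ih₂⟩ := ih
    constructor <;> intro b p q m hm hz
    · intro hq
      rw [turns]
      rcases List.sublist_cons_iff.1 hm with h | ⟨r, rfl, hr⟩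
      · split_ifs with hx
        · exact ih₂ b x q m h hz
        · refine ih₁ b x q m h hz ?_
          cases b <;> simp at hx hq ⊢ <;> omega
      · rw [ZigZag] at hz
        split_ifs with hx
        · simpa using ih₁ (!b) x x r hr hz.2 (by simp)
        · cases b <;> simp at hx hq hz <;> omega
    · rw [turns]
      rcases List.sublist_cons_iff.1 hm with h | ⟨r, rfl, hr⟩
      · split_ifs with hx
        · cases m with
          | nil => simp
          | cons y m =>
            simpa using ih₂ (!b) x y m ((List.sublist_cons_self y m).trans h) hz.2
        · exact ih₂ b x q m h hz
      · split_ifs with hx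
        · simpa using ih₂ (!b) x x r hr hz.2
        · simpa using ih₁ (!b) x x r hr hz.2 (by simp)

theorem exists_zigZag_length_eq_turns (l : List ℕ) (b : Bool) (p : ℕ) (hl : (p :: l).Nodup) :
    ∃ q m, (q :: m).Sublist (p :: l) ∧ ZigZag b q m ∧ m.length = turns b p l ∧
      (if b then p ≤ q else q ≤ p) := by
  induction l generalizing b p with
  | nil => exact ⟨p, [], by simp [ZigZag, turns]⟩
  | cons x l ih =>
    have hxp : p ≠ x := by simp at hl; tauto
    by_cases hx : decide (x < p) = b
    · rw [turns, if_pos hx]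
      obtain ⟨q, m, hs, hz, hm, hq⟩ := ih (!b) x hl.of_cons
      refine ⟨p, q :: m, hs.cons_cons p, ⟨?_, hz⟩, by simp [hm], by simp⟩
      cases b <;> simp at hx hq ⊢ <;> omega
    · rw [turns, if_neg hx]
      obtain ⟨q, m, hs, hz, hm, hq⟩ := ih b x hl.of_cons
      refine ⟨q, m, hs.cons p, hz, hm, ?_⟩
      cases b <;> simp at hx hq ⊢ <;> omega

theorem sSup_length_isAlt (l : List ℕ) (hl : l.Nodup) :
    sSup {k | ∃ m : List ℕ, m.Sublist l ∧ IsAlt m ∧ m.length = k} = turns false 0 l := by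
  apply IsGreatest.csSup_eq
  cases l with
  | nil => exact ⟨⟨[], by simp [IsAlt, turns]⟩, by rintro _ ⟨m, hm, -, rfl⟩; simp_all [turns]⟩
  | cons x l =>
    have hturns : turns false 0 (x :: l) = turns true x l + 1 := by simp [turns]
    rw [hturns]
    constructor
    · obtain ⟨q, m, hs, hz, hm, -⟩ := exists_zigZag_length_eq_turns l true x hl
      exact ⟨q :: m, hs, (isAlt_cons_iff q m).2 hz, by simp [hm]⟩
    · rintro _ ⟨m, hs, hm, rfl⟩
      cases m with
      | nil => simp
      | cons q m =>
        rw [isAlt_cons_iff] at hm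
        have hm' : m.Sublist l := hs.tail
        rw [List.length_cons, add_le_add_iff_right]
        rcases List.sublist_cons_iff.1 hs with h | ⟨r, h, hr⟩
        · rcases le_or_gt q x with hqx | hqx
          · exact (ZigZag.length_le_turns l).1 true x q m hm' hm hqx
          · simpa using (ZigZag.length_le_turns l).2 false x x (q :: m) h ⟨hqx, hm⟩
        · obtain ⟨rfl, rfl⟩ := List.cons.inj h
          exact (ZigZag.length_le_turns l).1 true q q m hr hm (by simp)

/-- How the number of turns changes when a new maximum `N` is inserted in all possible places. -/
theorem sum_turns_insertions (N : ℕ) (g : ℕ → ℤ) (l : List ℕ) (p : ℕ) (hp : p < N)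
    (hl : ∀ x ∈ l, x < N) :
    ((List.permutations'Aux N l).map fun m => g (turns false p m)).sum =
      turns false p l * g (turns false p l) + g (turns false p l + 1) +
        (l.length - turns false p l) * g (turns false p l + 2) ∧
    ((List.permutations'Aux N l).map fun m => g (turns true p m)).sum =
      match l with
      | [] => g 0
      | x :: _ =>
        if x < p then
          turns true p l * g (turns true p l) + g (turns true p l + 1) +
            (l.length - turns true p l) * g (turns true p l + 2)
        else
          (turns true p l + 1) * g (turns true p l) + g (turns true p l + 1) +
            (l.length - 1 - turns true p l) * g (turns true p l + 2) := by
  induction l generalizing p g with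
  | nil => simp [turns, not_lt.2 hp.le]
  | cons x l ih =>
    have hx : x < N := hl x (by simp)
    have hl' : ∀ y ∈ l, y < N := fun y hy => hl y (by simp [hy])
    have ih₀ := ih g x hx hl'
    have ih₁ := ih (fun k => g (k + 1)) x hx hl'
    rcases lt_or_ge x p with hxp | hxp
    · simp only [List.permutations'Aux, List.map_cons, List.sum_cons, List.map_map,
        Function.comp_def, turns, hxp, hx, not_lt.2 hp.le, if_true, if_false,
        decide_true, decide_false, Bool.not_true, Bool.not_false, List.length_cons,
        reduceCtorEq, ih₀.1, ih₁.1]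
      push_cast
      constructor <;> ring_nf
    · cases l with
      | nil =>
        simp [List.permutations'Aux, turns, not_lt.2 hxp, hx, not_lt.2 hp.le, not_lt.2 hx.le]
        constructor <;> exact add_comm _ _
      | cons y l =>
        have h₀ := ih₀.2
        have h₁ := ih₁.2
        clear ih ih₀ ih₁
        generalize hS₀ : (List.map (fun m => g (turns true x m)) _).sum = S₀ at h₀
        generalize hS₁ : (List.map (fun m => g (turns true x m + 1)) _).sum = S₁ at h₁
        rw [List.permutations'Aux, List.map_cons, List.map_cons, List.sum_cons, List.sum_cons,
          List.map_map, List.map_map]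
        simp only [Function.comp_def, turns.eq_2 _ p x, not_lt.2 hxp, hS₀, hS₁, turns.eq_2 _ p N,
          turns.eq_2 _ N x, not_lt.2 hp.le, hx, decide_true, decide_false, Bool.not_true,
          Bool.not_false, if_true, if_false, reduceCtorEq, h₀, h₁]
        by_cases hyx : y < x <;> simp [turns, hyx] <;> constructor <;> ring_nf

theorem sum_permutations'_cons (N : ℕ) (g : ℕ → ℤ) (l : List ℕ) (hl : ∀ x ∈ l, x < N) :
    (((N :: l).permutations').map fun m => g (turns false 0 m)).sum =
      (l.permutations'.map fun m =>
        turns false 0 m * g (turns false 0 m) + g (turns false 0 m + 1) +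
          (l.length - turns false 0 m) * g (turns false 0 m + 2)).sum := by
  rcases Nat.eq_zero_or_pos N with rfl | hN
  · have : l = [] := List.eq_nil_iff_forall_not_mem.2 fun x hx => by simpa using hl x hx
    simp [this, turns]
  rw [List.permutations', List.map_flatMap, List.flatMap, List.sum_flatten, List.map_map]
  congr 1
  refine List.map_congr_left fun m hm => ?_
  rw [List.mem_permutations'] at hm
  rw [← hm.length_eq]
  exact (sum_turns_insertions N g m 0 hN fun x hx => hl x (hm.mem_iff.1 hx)).1

theorem permList_nodup (n : ℕ) (w : Equiv.Perm (Fin n)) : (permList n w).Nodup :=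
  List.nodup_ofFn.2 (Fin.val_injective.comp w.injective)

theorem permList_injective (n : ℕ) : Function.Injective (permList n) := fun _ _ h =>
  Equiv.ext fun i => Fin.ext (congrFun (List.ofFn_injective h) i)

theorem asLen_eq_turns (n : ℕ) (w : Equiv.Perm (Fin n)) :
    asLen n w = turns false 0 (permList n w) :=
  sSup_length_isAlt _ (permList_nodup n w)

theorem permList_perm_range (n : ℕ) (w : Equiv.Perm (Fin n)) :
    (permList n w).Perm (List.range n).reverse := by
  rw [List.perm_ext_iff_of_nodup (permList_nodup n w) (List.nodup_reverse.2 List.nodup_range)]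
  intro a
  simp only [permList, List.mem_ofFn, List.mem_reverse, List.mem_range]
  exact ⟨by rintro ⟨i, rfl⟩; exact (w i).2, fun h => ⟨w.symm ⟨a, h⟩, by simp⟩⟩

theorem image_permList (n : ℕ) :
    Finset.univ.image (permList n) = (List.range n).reverse.permutations'.toFinset := by
  apply Finset.eq_of_subset_of_card_le
  · intro l hl
    obtain ⟨w, -, rfl⟩ := Finset.mem_image.1 hl
    simpa using permList_perm_range n w
  · rw [Finset.card_image_of_injective _ (permList_injective n)]
    refine (List.toFinset_card_le _).trans ?_
    rw [(List.permutations_perm_permutations' _).symm.length_eq]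
    simp [List.length_permutations, Fintype.card_perm]

/-- `bCount` as a sum over the lists built by repeatedly inserting a new maximum. -/
theorem bCount_eq_sum (n k : ℕ) :
    (bCount n k : ℤ) = ((List.range n).reverse.permutations'.map fun m =>
      if turns false 0 m ≤ k then (1 : ℤ) else 0).sum := by
  classical
  have hnd : (List.range n).reverse.permutations'.Nodup :=
    (List.permutations_perm_permutations' _).nodup_iff.1
      (List.nodup_permutations _ (List.nodup_reverse.2 List.nodup_range))
  rw [← List.sum_toFinset _ hnd, ← image_permList,
    Finset.sum_image (permList_injective n).injOn, bCount, Nat.card_eq_fintype_card,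
    Fintype.card_subtype]
  simp [asLen_eq_turns]

theorem bCount_succ (n k : ℕ) :
    (bCount (n + 1) k : ℤ) =
      k * bCount n k + (n + 1 - k) * (if 2 ≤ k then (bCount n (k - 2) : ℤ) else 0) := by
  have key := sum_permutations'_cons n (fun j => if j ≤ k then (1 : ℤ) else 0)
    (List.range n).reverse (by simp)
  rw [bCount_eq_sum, List.range_succ, List.reverse_append, List.reverse_singleton,
    List.singleton_append, key, bCount_eq_sum, bCount_eq_sum, ← List.sum_map_mul_left]
  have hpt : ∀ j : ℕ, (j : ℤ) * (if j ≤ k then 1 else 0) + (if j + 1 ≤ k then 1 else 0) +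
      ((n : ℤ) - j) * (if j + 2 ≤ k then 1 else 0) =
      k * (if j ≤ k then 1 else 0) +
        (n + 1 - k) * (if 2 ≤ k then (if j ≤ k - 2 then 1 else 0) else 0) := by
    intro j
    rcases lt_trichotomy (j + 1) k with h | h | h
    · rw [if_pos (by omega), if_pos (by omega), if_pos (by omega), if_pos (by omega),
        if_pos (by omega)]
      ring
    · subst h
      rw [if_pos (by omega), if_pos (by omega), if_neg (by omega)]
      split_ifs <;> omega
    · rcases Nat.lt_or_eq_of_le (Nat.le_of_lt_succ h) with h | h
      · rw [if_neg (by omega), if_neg (by omega), if_neg (by omega)]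
        split_ifs <;> omega
      · subst h
        rw [if_pos le_rfl, if_neg (by omega), if_neg (by omega)]
        split_ifs <;> omega
  simp only [List.length_reverse, List.length_range, hpt, List.sum_map_add,
    List.sum_map_mul_left]
  split_ifs <;> simp

theorem bCount_zero (k : ℕ) : bCount 0 k = 1 := by
  have := bCount_eq_sum 0 k
  simpa [turns] using this

open PowerSeries in
/-- The coefficient of `X ^ d` in `(1 - 2X) ^ n / (1 - X) ^ (r + d + 1)`. -/
noncomputable def ratCoeff (n d r : ℕ) : ℤ :=
  coeff d ((1 - 2 * X : ℤ⟦X⟧) ^ n * mk 1 ^ (r + d + 1))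

open PowerSeries in
theorem ratCoeff_eq_sum (n d r : ℕ) :
    ratCoeff n d r = ∑ s ∈ Finset.range (d + 1),
      (-2 : ℤ) ^ s * Nat.choose (r + 2 * d - s) (r + d) * Nat.choose n s := by
  have hpow (s : ℕ) : coeff s ((1 - 2 * X : ℤ⟦X⟧) ^ n) = (-2) ^ s * n.choose s := by
    have h : (1 - 2 * X : ℤ⟦X⟧) =
        ((1 + Polynomial.C (-2) * Polynomial.X : Polynomial ℤ) : ℤ⟦X⟧) := by
      simpa [sub_eq_add_neg] using
        (map_ofNat (Polynomial.coeToPowerSeries.ringHom (R := ℤ)) 2).symm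
    have h2 : (1 + Polynomial.C (-2) * Polynomial.X : Polynomial ℤ) ^ n =
        ((1 + Polynomial.X : Polynomial ℤ) ^ n).comp (Polynomial.C (-2) * Polynomial.X) := by simp
    rw [h, ← Polynomial.coe_pow, Polynomial.coeff_coe, h2, Polynomial.comp_C_mul_X_coeff,
      Polynomial.coeff_one_add_X_pow, mul_comm]
  rw [ratCoeff, mk_one_pow_eq_mk_choose_add, coeff_mul, Finset.Nat.sum_antidiagonal_eq_sum_range_succ
    (fun i j => coeff i ((1 - 2 * X : ℤ⟦X⟧) ^ n) * coeff j _)]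
  refine Finset.sum_congr rfl fun s hs => ?_
  have : r + d + (d - s) = r + 2 * d - s := by rw [Finset.mem_range] at hs; omega
  rw [hpow, coeff_mk, this]
  ring

theorem ratCoeff_zero_right (n r : ℕ) : ratCoeff n 0 r = 1 := by simp [ratCoeff_eq_sum]

open PowerSeries in
theorem ratCoeff_succ (n d r : ℕ) :
    r * ratCoeff (n + 1) (d + 1) r =
      (r + 2 * d + 2) * ratCoeff n (d + 1) r + 4 * (n - 1 - r - 2 * d) * ratCoeff n d r := by
  set I : ℤ⟦X⟧ := mk 1 with hI
  have hI1 : I * (1 - X) = 1 := mk_one_mul_one_sub_eq_one ℤ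
  have hdI : derivative ℤ I = I ^ 2 := by
    have := congrArg (derivative ℤ) hI1
    simp only [Derivation.leibniz, map_sub, Derivation.map_one_eq_zero, derivative_X,
      smul_eq_mul] at this
    linear_combination I * this - (derivative ℤ I) * hI1
  set Y : ℤ⟦X⟧ := (1 - 2 * X) ^ (n + 1) * I ^ (r + d + 1) with hY
  have hdX : derivative ℤ (1 - 2 * X : ℤ⟦X⟧) = -2 := by
    rw [map_sub, Derivation.map_one_eq_zero, Derivation.leibniz, derivative_X,
      show (2 : ℤ⟦X⟧) = ((2 : ℕ) : ℤ⟦X⟧) from rfl, Derivation.map_natCast]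
    simp
  set V : ℤ⟦X⟧ := (1 - 2 * X) ^ n * I ^ (r + d + 1) with hV
  have hdY : derivative ℤ Y =
      V * (-2 * ((n : ℤ⟦X⟧) + 1) + ((r : ℤ⟦X⟧) + (d : ℤ⟦X⟧) + 1) * (1 - 2 * X) * I) := by
    rw [hY, hV, Derivation.leibniz, Derivation.leibniz_pow, Derivation.leibniz_pow, hdI, hdX]
    simp only [smul_eq_mul, nsmul_eq_mul, Nat.add_sub_cancel]
    push_cast
    ring
  have hmul (a : ℤ) (f : ℤ⟦X⟧) : coeff (d + 1) ((a : ℤ⟦X⟧) * f) = a * coeff (d + 1) f := by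
    rw [← zsmul_eq_mul, map_zsmul, smul_eq_mul]
  have hc : coeff (d + 1) (X * derivative ℤ Y) = (d + 1) * coeff (d + 1) Y := by
    rw [coeff_succ_X_mul, coeff_derivative]; ring
  have hid : ((r : ℤ) : ℤ⟦X⟧) * ((1 - 2 * X) ^ (n + 1) * I ^ (r + (d + 1) + 1)) =
      ((r + 2 * d + 2 : ℤ) : ℤ⟦X⟧) * ((1 - 2 * X) ^ n * I ^ (r + (d + 1) + 1)) +
      ((4 * (n - 1 - r - 2 * d) : ℤ) : ℤ⟦X⟧) * (X * V) +
      ((2 : ℤ) : ℤ⟦X⟧) * (X * derivative ℤ Y) - ((2 * (d + 1) : ℤ) : ℤ⟦X⟧) * Y := by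
    rw [hdY, hY, hV]
    push_cast
    linear_combination ((1 - 2 * X) ^ n * I ^ (r + d + 1) *
      (-(2 * (d : ℤ⟦X⟧) + 2) - (4 * (r : ℤ⟦X⟧) + 4 * (d : ℤ⟦X⟧) + 4) * X)) * hI1
  have := congrArg (coeff (d + 1)) hid
  rw [map_sub, map_add, map_add, hmul, hmul, hmul, hmul, hmul, hc, coeff_succ_X_mul] at this
  simp only [ratCoeff, ← hI, ← hV]
  linear_combination this

/-- The right-hand side of the formula, doubled and grouped by `r = k - 2d`, with the term `r = 0`
counted once: it matters only for `n = 0`. -/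
noncomputable def weightedSum (n k : ℕ) : ℤ :=
  ∑ d ∈ Finset.range (k / 2 + 1),
    (if k - 2 * d = 0 then 1 else 2) * ratCoeff n d (k - 2 * d) * ((k - 2 * d : ℕ) : ℤ) ^ n

theorem weightedSum_succ (n k : ℕ) :
    weightedSum (n + 1) k = k * weightedSum n k +
      4 * (n + 1 - k) * (if 2 ≤ k then weightedSum n (k - 2) else 0) := by
  match k with
  | 0 => simp [weightedSum]
  | 1 => simp [weightedSum, ratCoeff_zero_right]
  | k + 2 =>
    rw [if_pos (by omega), Nat.add_sub_cancel]
    simp only [weightedSum, show (k + 2) / 2 + 1 = k / 2 + 1 + 1 by omega]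
    rw [Finset.sum_range_succ', Finset.sum_range_succ' _ (k / 2 + 1), mul_add,
      add_right_comm, Finset.mul_sum, Finset.mul_sum, ← Finset.sum_add_distrib]
    congr 1
    · refine Finset.sum_congr rfl fun d hd => ?_
      have hd' : 2 * d ≤ k := by rw [Finset.mem_range] at hd; omega
      obtain ⟨r, rfl⟩ := Nat.exists_eq_add_of_le' hd'
      rw [show r + 2 * d + 2 - 2 * (d + 1) = r by omega, Nat.add_sub_cancel]
      have h := ratCoeff_succ n d r
      push_cast
      linear_combination ((if r = 0 then 1 else 2) * (r : ℤ) ^ n) * h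
    · simp [ratCoeff_zero_right]
      ring

theorem sum_choose_weighted (k : ℕ) :
    ∑ d ∈ Finset.range (k / 2 + 1), (if k - 2 * d = 0 then 1 else 2) * k.choose d = 2 ^ k := by
  rcases Nat.even_or_odd' k with ⟨m, rfl | rfl⟩
  · rw [Nat.mul_div_cancel_left m two_pos, Finset.sum_range_succ, if_pos (by omega), one_mul]
    have h1 : ∑ d ∈ Finset.range m, (if 2 * m - 2 * d = 0 then 1 else 2) * (2 * m).choose d =
        2 * ∑ d ∈ Finset.range m, (2 * m).choose d := by
      rw [Finset.mul_sum]
      refine Finset.sum_congr rfl fun d hd => ?_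
      rw [Finset.mem_range] at hd
      rw [if_neg (by omega)]
    have h2 := Nat.sum_range_choose_halfway m
    rw [Finset.sum_range_succ'] at h2
    simp only [Nat.choose_succ_succ', Finset.sum_add_distrib] at h2
    have h3 := Finset.sum_range_succ' (fun d => (2 * m).choose d) m
    rw [Finset.sum_range_succ] at h3
    rw [h1, pow_mul]
    norm_num at h2 h3 ⊢
    omega
  · rw [show (2 * m + 1) / 2 = m by omega, pow_succ, pow_mul, show 2 ^ 2 = 4 from rfl,
      ← Nat.sum_range_choose_halfway m, Finset.sum_mul]
    refine Finset.sum_congr rfl fun d hd => ?_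
    rw [Finset.mem_range] at hd
    rw [if_neg (by omega), mul_comm]

theorem weightedSum_zero (k : ℕ) : weightedSum 0 k = 2 ^ k := by
  have h := congrArg (Nat.cast : ℕ → ℤ) (sum_choose_weighted k)
  push_cast at h
  rw [← h, weightedSum]
  refine Finset.sum_congr rfl fun d hd => ?_
  have hd' : 2 * d ≤ k := by rw [Finset.mem_range] at hd; omega
  have hc : ratCoeff 0 d (k - 2 * d) = k.choose d := by
    rw [ratCoeff, pow_zero, one_mul, PowerSeries.mk_one_pow_eq_mk_choose_add,
      PowerSeries.coeff_mk, show k - 2 * d + d + d = k by omega, ← Nat.choose_symm (by omega),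
      show k - (k - 2 * d + d) = d by omega]
  rw [hc, pow_zero, mul_one]

theorem two_pow_mul_bCount (n k : ℕ) : (2 ^ k * bCount n k : ℤ) = weightedSum n k := by
  induction n generalizing k with
  | zero => simp [bCount_zero, weightedSum_zero]
  | succ n ih =>
    rw [weightedSum_succ, bCount_succ, ← ih]
    split_ifs with hk
    · obtain ⟨k, rfl⟩ := Nat.exists_eq_add_of_le' hk
      rw [Nat.add_sub_cancel, ← ih]
      ring
    · ring

theorem weightedSum_eq (n k : ℕ) (hn : 1 ≤ n) :
    weightedSum n k = 2 * ∑ p ∈ (Finset.range (k + 1) ×ˢ Finset.range (k + 1)).filter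
      (fun p => p.1 + 2 * p.2 ≤ k ∧ p.1 % 2 = k % 2),
        (-2 : ℤ) ^ p.2 * Nat.choose (k - p.2) ((k + p.1) / 2) *
          Nat.choose n p.2 * (p.1 : ℤ) ^ n := by
  have h (d : ℕ) : (if k - 2 * d = 0 then 1 else 2) * ratCoeff n d (k - 2 * d) *
      ((k - 2 * d : ℕ) : ℤ) ^ n = 2 * (ratCoeff n d (k - 2 * d) * ((k - 2 * d : ℕ) : ℤ) ^ n) := by
    split_ifs with h0
    · simp [h0, show n ≠ 0 by omega]
    · ring
  rw [weightedSum, Finset.sum_congr rfl fun d _ => h d, ← Finset.mul_sum]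
  simp only [ratCoeff_eq_sum, Finset.sum_mul]
  rw [Finset.sum_sigma']
  congr 1
  refine Finset.sum_bij' (fun p _ => (k - 2 * p.1, p.2)) (fun p _ => ⟨(k - p.1) / 2, p.2⟩)
    ?_ ?_ ?_ ?_ ?_
  · rintro ⟨d, s⟩ h
    simp only [Finset.mem_sigma, Finset.mem_range] at h
    simp only [Finset.mem_filter, Finset.mem_product, Finset.mem_range]
    omega
  · rintro ⟨r, s⟩ h
    simp only [Finset.mem_filter, Finset.mem_product, Finset.mem_range] at h
    simp only [Finset.mem_sigma, Finset.mem_range]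
    omega
  · rintro ⟨d, s⟩ h
    simp only [Finset.mem_sigma, Finset.mem_range] at h
    simp only [Sigma.mk.injEq, heq_eq_eq, and_true]
    omega
  · rintro ⟨r, s⟩ h
    simp only [Finset.mem_filter, Finset.mem_product, Finset.mem_range] at h
    simp only [Prod.mk.injEq, and_true]
    omega
  · rintro ⟨d, s⟩ h
    simp only [Finset.mem_sigma, Finset.mem_range] at h
    rw [show k - 2 * d + 2 * d - s = k - s by omega,
      show (k + (k - 2 * d)) / 2 = k - 2 * d + d by omega]

theorem bCount_formula (k n : ℕ) (hk : 1 ≤ k) (hn : 1 ≤ n) :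
    (2 ^ (k - 1) * bCount n k : ℤ) =
      ∑ p ∈ (Finset.range (k + 1) ×ˢ Finset.range (k + 1)).filter
          (fun p => p.1 + 2 * p.2 ≤ k ∧ p.1 % 2 = k % 2),
        (-2 : ℤ) ^ p.2 * Nat.choose (k - p.2) ((k + p.1) / 2) *
          Nat.choose n p.2 * (p.1 : ℤ) ^ n := by
  have h := (two_pow_mul_bCount n k).trans (weightedSum_eq n k hn)
  obtain ⟨k, rfl⟩ := Nat.exists_eq_add_of_le' hk
  rw [pow_succ', mul_assoc] at h
  exact mul_left_cancel₀ two_ne_zero h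
end

section
/- For n ≥ 4, the variance of as(w) over uniformly random w ∈ S_n equals (32n - 13)/180. -/
/-- A list is alternating, starting with a descent if `d` is true and with an ascent otherwise. -/
def AltFrom : Bool → List ℕ → Prop
  | _, [] => True
  | _, [_] => True
  | d, a :: b :: t => (if d then b < a else a < b) ∧ AltFrom (!d) (b :: t)

/-- The maximal length of an alternating subsequence with prescribed starting direction, computed
greedily (for lists whose neighbouring entries are distinct). -/
def greedyLen : Bool → List ℕ → ℕ
  | _, [] => 0
  | _, [_] => 1
  | d, a :: b :: t =>
    if decide (b < a) = d then 1 + greedyLen (!d) (b :: t) else greedyLen d (b :: t)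

theorem altFrom_iff (d : Bool) (l : List ℕ) :
    AltFrom d l ↔ ∀ i : ℕ, ∀ hi : i + 1 < l.length,
      if decide (i % 2 = 0) = d then l.get ⟨i + 1, hi⟩ < l.get ⟨i, Nat.lt_of_succ_lt hi⟩
      else l.get ⟨i, Nat.lt_of_succ_lt hi⟩ < l.get ⟨i + 1, hi⟩ := by
  fun_induction AltFrom d l with
  | case1 => simp
  | case2 => simp
  | case3 d a b t ih =>
    rw [ih]
    constructor
    · rintro ⟨h0, h⟩ i hi
      cases i with
      | zero => cases d <;> simpa using h0
      | succ i =>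
        have := h i (by simpa using hi)
        rcases Nat.mod_two_eq_zero_or_one i with hp | hp <;> cases d <;>
          simp_all [Nat.add_mod]
    · intro h
      refine ⟨?_, fun i hi => ?_⟩
      · have := h 0 (by simp)
        cases d <;> simpa using this
      · have := h (i + 1) (by simpa using hi)
        rcases Nat.mod_two_eq_zero_or_one i with hp | hp <;> cases d <;>
          simp_all [Nat.add_mod]

theorem isAlt_iff_altFrom (l : List ℕ) : IsAlt l ↔ AltFrom true l := by
  rw [altFrom_iff]
  simp [IsAlt]

theorem AltFrom.tail {d : Bool} {a : ℕ} {l : List ℕ} (h : AltFrom d (a :: l)) :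
    AltFrom (!d) l := by
  cases l with
  | nil => trivial
  | cons b t => exact h.2

theorem greedyLen_le_succ (d : Bool) (l : List ℕ) : greedyLen d l ≤ 1 + greedyLen (!d) l := by
  fun_induction greedyLen d l with
  | case1 => simp
  | case2 => simp
  | case3 a b t ih => simp [greedyLen]
  | case4 d a b t h ih =>
    have : decide (b < a) = !d := by
      cases d <;> simp_all
    rw [greedyLen, if_pos this, Bool.not_not]
    omega

theorem exists_altFrom_sublist (d : Bool) (a : ℕ) (l : List ℕ) (hl : (a :: l).Nodup) :
    ∃ b t, (b :: t).Sublist (a :: l) ∧ AltFrom d (b :: t) ∧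
      (b :: t).length = greedyLen d (a :: l) ∧ (if d then a ≤ b else b ≤ a) := by
  induction l generalizing d a with
  | nil => exact ⟨a, [], by simp, trivial, rfl, by simp⟩
  | cons c l ih =>
    have hac : a ≠ c := by
      rintro rfl
      simp at hl
    rw [greedyLen]
    by_cases h : decide (c < a) = d
    · rw [if_pos h]
      obtain ⟨b, t, hs, halt, hlen, hb⟩ := ih (!d) c hl.tail
      refine ⟨a, b :: t, hs.cons_cons a, ⟨?_, halt⟩, ?_, by simp⟩
      · cases d <;> simp_all <;> omega
      · rw [List.length_cons, hlen, Nat.add_comm]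
    · rw [if_neg h]
      obtain ⟨b, t, hs, halt, hlen, hb⟩ := ih d c hl.tail
      refine ⟨b, t, hs.cons a, halt, hlen, ?_⟩
      cases d <;> simp_all <;> omega

theorem length_le_greedyLen {d : Bool} {s l : List ℕ} (hl : l.Nodup) (hs : s.Sublist l)
    (halt : AltFrom d s) : s.length ≤ greedyLen d l := by
  induction l generalizing d s with
  | nil => simp_all
  | cons a l ih =>
    cases l with
    | nil => simpa [greedyLen] using hs.length_le
    | cons c l =>
      have hac : a ≠ c := by
        rintro rfl
        simp at hl
      rw [greedyLen]
      cases hs with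
      | cons _ hs =>
        have := ih hl.tail hs halt
        have := greedyLen_le_succ d (c :: l)
        split_ifs <;> omega
      | cons_cons _ hs =>
        rename_i s
        split_ifs with h
        · have := ih hl.tail hs halt.tail
          simp only [List.length_cons]
          omega
        · have key : (c :: s).Sublist (c :: l) ∧ AltFrom d (c :: s) := by
            cases hs with
            | cons _ hs =>
              refine ⟨hs.cons_cons c, ?_⟩
              cases s with
              | nil => trivial
              | cons b s =>
                refine ⟨?_, halt.2⟩
                have := halt.1
                cases d <;> simp_all <;> omega
            | cons_cons _ hs =>
              have := halt.1
              cases d <;> simp_all <;> omega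
          simpa using ih hl.tail key.1 key.2

theorem asLen_eq_greedyLen (n : ℕ) (w : Equiv.Perm (Fin n)) :
    asLen n w = greedyLen true (permList n w) := by
  refine IsGreatest.csSup_eq ⟨?_, ?_⟩
  · have hnd := permList_nodup n w
    cases hp : permList n w with
    | nil => exact ⟨[], by simp [IsAlt, greedyLen]⟩
    | cons a l =>
      obtain ⟨b, t, hs, halt, hlen, -⟩ := exists_altFrom_sublist true a l (hp ▸ hnd)
      exact ⟨b :: t, hs, (isAlt_iff_altFrom _).2 halt, hlen⟩
  · rintro _ ⟨s, hs, halt, rfl⟩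
    exact length_le_greedyLen (permList_nodup n w) hs ((isAlt_iff_altFrom s).1 halt)

/-- Indicator of a local extremum of `u` at position `i + 1`. -/
def extremum (u : ℕ → ℕ) (i : ℕ) : ℕ :=
  if decide (u (i + 1) < u i) = decide (u (i + 2) < u (i + 1)) then 0 else 1

/-- One, plus one if `u` starts with a descent, plus the number of the first `m` interior
positions at which `u` has a local extremum. -/
def turnCount (u : ℕ → ℕ) (m : ℕ) : ℕ :=
  1 + (if u 1 < u 0 then 1 else 0) + ∑ i ∈ Finset.range m, extremum u i

theorem turnCount_succ (u : ℕ → ℕ) (m : ℕ) :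
    turnCount u (m + 1) = turnCount u m + extremum u m := by
  rw [turnCount, turnCount, Finset.sum_range_succ, ← add_assoc]

theorem greedyLen_eq (d : Bool) (a b : ℕ) (l : List ℕ) :
    greedyLen d (a :: b :: l) = 1 + (if decide (b < a) = d then 1 else 0) +
      ∑ i ∈ Finset.range l.length, extremum (fun j => (a :: b :: l).getD j 0) i := by
  induction l generalizing d a b with
  | nil =>
    simp only [greedyLen]
    split_ifs <;> simp
  | cons c l ih =>
    rw [greedyLen, ih, ih, List.length_cons, Finset.sum_range_succ']
    have h0 : extremum (fun j => (a :: b :: c :: l).getD j 0) 0 =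
        if decide (b < a) = decide (c < b) then 0 else 1 := by
      simp [extremum]
    have hs : ∀ i, extremum (fun j => (a :: b :: c :: l).getD j 0) (i + 1) =
        extremum (fun j => (b :: c :: l).getD j 0) i := fun i => by simp [extremum]
    simp only [h0, hs]
    generalize decide (b < a) = p
    generalize decide (c < b) = q
    cases p <;> cases q <;> cases d <;> simp <;> omega

/-- The values of a permutation of `Fin n`, extended by zero. -/
def permVal {n : ℕ} (w : Equiv.Perm (Fin n)) (i : ℕ) : ℕ := (permList n w).getD i 0

theorem permVal_of_lt {n : ℕ} (w : Equiv.Perm (Fin n)) {i : ℕ} (hi : i < n) :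
    permVal w i = w ⟨i, hi⟩ := by
  simp [permVal, permList, hi]

theorem asLen_eq_turnCount (m : ℕ) (w : Equiv.Perm (Fin (m + 2))) :
    asLen (m + 2) w = turnCount (permVal w) m := by
  rw [asLen_eq_greedyLen]
  have hlen : (permList (m + 2) w).length = m + 2 := by simp [permList]
  unfold turnCount permVal
  match hp : permList (m + 2) w with
  | [] => simp [hp] at hlen
  | [_] => simp [hp] at hlen
  | a :: b :: l =>
    have : l.length = m := by simpa [hp] using hlen
    rw [greedyLen_eq, this]
    simp

/-- The table of strict comparisons between the values of a tuple. -/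
def comparisons {k : ℕ} (v : Fin k → ℕ) (i j : Fin k) : Bool := decide (v i < v j)

theorem exists_perm_comparisons {k : ℕ} (v : Fin k → ℕ) (hv : Function.Injective v) :
    ∃ τ : Equiv.Perm (Fin k), ∀ i j, v i < v j ↔ τ i < τ j := by
  have hm : StrictMono (v ∘ Tuple.sort v) :=
    (Tuple.monotone_sort v).strictMono_of_injective (hv.comp (Tuple.sort v).injective)
  refine ⟨(Tuple.sort v)⁻¹, fun i j => ?_⟩
  rw [← hm.lt_iff_lt]
  simp

/-- Averaging over the relative order of the entries at the positions in the range of `e`. -/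
theorem sum_pattern_mul {n k : ℕ} (e : Fin k ↪ Fin n)
    (G : (Fin k → Fin k → Bool) → ℕ) (h : Equiv.Perm (Fin n) → ℕ)
    (hinv : ∀ (w : Equiv.Perm (Fin n)) (σ : Equiv.Perm (Fin k)),
      h (w * σ.viaEmbedding e) = h w) :
    k.factorial * ∑ w : Equiv.Perm (Fin n), G (comparisons fun i => w (e i)) * h w =
      (∑ σ : Equiv.Perm (Fin k), G (comparisons fun i => σ i)) * ∑ w, h w := by
  have hinner : ∀ w : Equiv.Perm (Fin n),
      ∑ σ : Equiv.Perm (Fin k), G (comparisons fun i => w (e (σ i))) =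
        ∑ σ : Equiv.Perm (Fin k), G (comparisons fun i => σ i) := by
    intro w
    obtain ⟨τ, hτ⟩ := exists_perm_comparisons (fun i => (w (e i) : ℕ))
      (Fin.val_injective.comp (w.injective.comp e.injective))
    rw [← Equiv.sum_comp (Equiv.mulLeft τ)
      (fun σ => G (comparisons fun i => (σ i : ℕ)))]
    refine Finset.sum_congr rfl fun σ _ => congrArg G ?_
    funext i j
    simp only [comparisons, Equiv.coe_mulLeft, Equiv.Perm.coe_mul, Function.comp_apply]
    exact decide_eq_decide.2 (hτ (σ i) (σ j))
  calc k.factorial * ∑ w : Equiv.Perm (Fin n), G (comparisons fun i => w (e i)) * h w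
      = ∑ _σ : Equiv.Perm (Fin k), ∑ w : Equiv.Perm (Fin n),
          G (comparisons fun i => w (e i)) * h w := by
        simp [Fintype.card_perm]
    _ = ∑ σ : Equiv.Perm (Fin k), ∑ w : Equiv.Perm (Fin n),
          G (comparisons fun i => w (e (σ i))) * h w := by
        refine Finset.sum_congr rfl fun σ _ => ?_
        rw [← Equiv.sum_comp (Equiv.mulRight (σ.viaEmbedding e))]
        refine Finset.sum_congr rfl fun w _ => ?_
        simp only [Equiv.coe_mulRight, hinv, Equiv.Perm.coe_mul, Function.comp_apply,
          Equiv.Perm.viaEmbedding_apply]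
    _ = _ := by
        rw [Finset.sum_comm, Finset.mul_sum]
        refine Finset.sum_congr rfl fun w _ => ?_
        rw [← Finset.sum_mul, hinner]

/-- The window of `k` consecutive positions starting at `s`. -/
def window {n : ℕ} (s k : ℕ) (h : s + k ≤ n) : Fin k ↪ Fin n where
  toFun i := ⟨s + i, by omega⟩
  inj' i j hij := by
    ext
    simpa using hij

theorem comparisons_window {n s k : ℕ} (h : s + k ≤ n) (w : Equiv.Perm (Fin n)) (i j : Fin k) :
    comparisons (fun i => w (window s k h i)) i j =
      decide (permVal w (s + i) < permVal w (s + j)) := by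
  rw [permVal_of_lt w (by omega : s + i < n), permVal_of_lt w (by omega : s + j < n)]
  rfl

theorem permVal_mul_viaEmbedding_window {n s k : ℕ} (h : s + k ≤ n) (w : Equiv.Perm (Fin n))
    (σ : Equiv.Perm (Fin k)) {i : ℕ} (hi : i < s) :
    permVal (w * σ.viaEmbedding (window s k h)) i = permVal w i := by
  rw [permVal_of_lt _ (by omega : i < n), permVal_of_lt _ (by omega : i < n),
    Equiv.Perm.mul_apply, Equiv.Perm.viaEmbedding_apply_of_notMem]
  rintro ⟨j, hj⟩
  have := congrArg Fin.val hj
  change s + (j : ℕ) = i at this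
  omega

theorem turnCount_congr {u v : ℕ → ℕ} {m : ℕ} (h : ∀ i < m + 2, u i = v i) :
    turnCount u m = turnCount v m := by
  unfold turnCount
  rw [h 0 (by omega), h 1 (by omega)]
  congr 1
  refine Finset.sum_congr rfl fun i hi => ?_
  have := Finset.mem_range.1 hi
  rw [extremum, extremum, h i (by omega), h (i + 1) (by omega), h (i + 2) (by omega)]

/-- Indicator of a local extremum at position `b`, from the comparison table. -/
def extremumAt {k : ℕ} (c : Fin k → Fin k → Bool) (a b d : Fin k) : ℕ :=
  if c b a = c d b then 0 else 1

theorem six_mul_sum_extremum_mul {n m : ℕ} (hm : m + 3 ≤ n) (h : Equiv.Perm (Fin n) → ℕ)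
    (hinv : ∀ (w : Equiv.Perm (Fin n)) (σ : Equiv.Perm (Fin 3)),
      h (w * σ.viaEmbedding (window m 3 hm)) = h w) :
    6 * ∑ w : Equiv.Perm (Fin n), extremum (permVal w) m * h w = 4 * ∑ w, h w := by
  have key := sum_pattern_mul (window m 3 hm) (fun c => extremumAt c 0 1 2) h hinv
  have hc : ∑ σ : Equiv.Perm (Fin 3), extremumAt (comparisons fun i => (σ i : ℕ)) 0 1 2 = 4 := by
    decide +kernel
  rw [hc] at key
  simpa [extremumAt, comparisons_window, extremum, Nat.factorial] using key

theorem sum_extremum {n m : ℕ} (hm : m + 3 ≤ n) :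
    6 * ∑ w : Equiv.Perm (Fin n), extremum (permVal w) m = 4 * n.factorial := by
  simpa [Fintype.card_perm] using six_mul_sum_extremum_mul hm (fun _ => 1) (by simp)

theorem sum_adjacent_extrema {n m : ℕ} (hm : m + 5 ≤ n) :
    120 * ∑ w : Equiv.Perm (Fin n),
      (extremum (permVal w) m + extremum (permVal w) (m + 1)) * extremum (permVal w) (m + 2) =
      104 * n.factorial := by
  have key := sum_pattern_mul (window m 5 hm)
    (fun c => (extremumAt c 0 1 2 + extremumAt c 1 2 3) * extremumAt c 2 3 4) (fun _ => 1)
    (by simp)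
  have hc : ∑ σ : Equiv.Perm (Fin 5),
      (extremumAt (comparisons fun i => (σ i : ℕ)) 0 1 2 +
        extremumAt (comparisons fun i => (σ i : ℕ)) 1 2 3) *
        extremumAt (comparisons fun i => (σ i : ℕ)) 2 3 4 = 104 := by
    decide +kernel
  rw [hc] at key
  simpa [extremumAt, comparisons_window, extremum, Nat.factorial, Fintype.card_perm] using key

theorem sum_turnCount_zero {n : ℕ} (hn : 2 ≤ n) :
    2 * ∑ w : Equiv.Perm (Fin n), turnCount (permVal w) 0 = 3 * n.factorial := by
  have key := sum_pattern_mul (window 0 2 (n := n) (by omega))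
    (fun c => 1 + (if c 1 0 then 1 else 0)) (fun _ => 1) (by simp)
  have hc : ∑ σ : Equiv.Perm (Fin 2),
      (1 + (if comparisons (fun i => (σ i : ℕ)) 1 0 then 1 else 0)) = 3 := by
    decide +kernel
  rw [hc] at key
  simpa [comparisons_window, turnCount, Nat.factorial, Fintype.card_perm] using key

theorem sum_turnCount_two_sq {n : ℕ} (hn : 4 ≤ n) :
    24 * ∑ w : Equiv.Perm (Fin n), turnCount (permVal w) 2 ^ 2 = 208 * n.factorial := by
  have key := sum_pattern_mul (window 0 4 (n := n) (by omega))
    (fun c => (1 + (if c 1 0 then 1 else 0) + (extremumAt c 0 1 2 + extremumAt c 1 2 3)) ^ 2)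
    (fun _ => 1) (by simp)
  have hc : ∑ σ : Equiv.Perm (Fin 4),
      (1 + (if comparisons (fun i => (σ i : ℕ)) 1 0 then 1 else 0) +
        (extremumAt (comparisons fun i => (σ i : ℕ)) 0 1 2 +
          extremumAt (comparisons fun i => (σ i : ℕ)) 1 2 3)) ^ 2 = 208 := by
    decide +kernel
  rw [hc] at key
  simpa [extremumAt, comparisons_window, extremum, turnCount, Nat.factorial, Fintype.card_perm,
    Finset.sum_range_succ] using key

theorem sum_turnCount {n m : ℕ} (hm : m + 2 ≤ n) :
    6 * ∑ w : Equiv.Perm (Fin n), turnCount (permVal w) m = (4 * m + 9) * n.factorial := by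
  induction m with
  | zero =>
    have := sum_turnCount_zero hm
    linarith
  | succ m ih =>
    have h1 := ih (by omega)
    have h2 := sum_extremum (n := n) (m := m) (by omega)
    simp only [turnCount_succ, Finset.sum_add_distrib]
    linarith

theorem sum_extremum_mul_turnCount {n m : ℕ} (hm : m + 5 ≤ n) :
    6 * ∑ w : Equiv.Perm (Fin n), extremum (permVal w) (m + 2) * turnCount (permVal w) m =
      4 * ∑ w : Equiv.Perm (Fin n), turnCount (permVal w) m :=
  six_mul_sum_extremum_mul hm _ fun w σ =>
    turnCount_congr fun _ hi => permVal_mul_viaEmbedding_window (s := m + 2) hm w σ hi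

theorem sum_turnCount_sq {n m : ℕ} (hm : m + 4 ≤ n) :
    (∑ w : Equiv.Perm (Fin n), (turnCount (permVal w) (m + 2) : ℚ) ^ 2) =
      ((32 * (m + 4) - 13) / 180 + ((4 * m + 17) / 6) ^ 2) * n.factorial := by
  induction m with
  | zero =>
    have := congrArg (Nat.cast : ℕ → ℚ) (sum_turnCount_two_sq hm)
    push_cast at this ⊢
    linarith
  | succ m ih =>
    have h0 := ih (by omega)
    have h1 := congrArg (Nat.cast : ℕ → ℚ) (sum_turnCount (n := n) (m := m) (by omega))
    have h2 := congrArg (Nat.cast : ℕ → ℚ) (sum_extremum (n := n) (m := m + 2) (by omega))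
    have h3 := congrArg (Nat.cast : ℕ → ℚ) (sum_extremum_mul_turnCount (n := n) (m := m) (by omega))
    have h4 := congrArg (Nat.cast : ℕ → ℚ) (sum_adjacent_extrema (n := n) (m := m) (by omega))
    have hsq : ∀ w : Equiv.Perm (Fin n), (turnCount (permVal w) (m + 1 + 2) : ℚ) ^ 2 =
        (turnCount (permVal w) (m + 2) : ℚ) ^ 2 +
        2 * (extremum (permVal w) (m + 2) * turnCount (permVal w) m) +
        2 * ((extremum (permVal w) m + extremum (permVal w) (m + 1)) *
          extremum (permVal w) (m + 2)) + extremum (permVal w) (m + 2) := by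
      intro w
      have hx : (extremum (permVal w) (m + 2) : ℚ) ^ 2 = extremum (permVal w) (m + 2) := by
        rw [extremum]
        split_ifs <;> simp
      rw [show m + 1 + 2 = m + 2 + 1 by ring, turnCount_succ _ (m + 2), turnCount_succ _ (m + 1),
        turnCount_succ _ m]
      push_cast
      linear_combination hx
    simp only [hsq, Finset.sum_add_distrib, ← Finset.mul_sum]
    push_cast at h1 h2 h3 h4 ⊢
    rw [h0]
    linear_combination h3 / 3 + h4 / 60 + h2 / 6 + h1 * (2 / 9)

theorem asLen_variance (n : ℕ) (hn : 4 ≤ n) :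
    (∑ w : Equiv.Perm (Fin n), (asLen n w : ℚ) ^ 2) / n.factorial -
      ((∑ w : Equiv.Perm (Fin n), (asLen n w : ℚ)) / n.factorial) ^ 2
      = (32 * n - 13) / 180 := by
  obtain ⟨m, rfl⟩ : ∃ m, n = m + 4 := ⟨n - 4, by omega⟩
  have h1 := congrArg (Nat.cast : ℕ → ℚ) (sum_turnCount (n := m + 4) (m := m + 2) le_rfl)
  have hf : ((m + 4).factorial : ℚ) ≠ 0 := by positivity
  simp only [asLen_eq_turnCount (m + 2)]
  push_cast at h1 ⊢
  have hmean : (∑ w : Equiv.Perm (Fin (m + 4)), (turnCount (permVal w) (m + 2) : ℚ)) =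
      (4 * m + 17) / 6 * (m + 4).factorial := by
    linear_combination h1 / 6
  rw [sum_turnCount_sq le_rfl, hmean, mul_div_cancel_right₀ _ hf, mul_div_cancel_right₀ _ hf]
  ring
end
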